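/- arXiv:0705.3425 — 6 statements merged into one kernel-verified Lean document; each statement's English description precedes it below -/
import Mathlib

section
/- Let X be a topological space and 𝔅 a basis of open sets of X closed under finite intersections. If (X,𝔅) is constructibly normal, then X̃ is a normal topological space (not necessarily Hausdorff): any two disjoint closed subsets of X̃ can be separated by disjoint open subsets of X̃. -/
/-!
Statement 0: For a topological space `X` with a basis `B` of open sets closed under
finite intersections, the space `X̃` of ultrafilters of constructible sets, with the
spectral topology, is a spectral space.
-/

open Set TopologicalSpace

/-- The Boolean algebra of subsets of `X` generated by the basis `B`:
the constructible sets. -/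
inductive IsCons {X : Type*} (B : Set (Set X)) : Set X → Prop
  | basic (s : Set X) (hs : s ∈ B) : IsCons B s
  | univ : IsCons B Set.univ
  | compl (s : Set X) (hs : IsCons B s) : IsCons B sᶜ
  | inter (s t : Set X) (hs : IsCons B s) (ht : IsCons B t) : IsCons B (s ∩ t)

/-- An ultrafilter of constructible sets: a maximal family of constructible sets closed
under finite intersections and not containing the empty set. -/
structure UltraCons {X : Type*} (B : Set (Set X)) where
  sets : Set (Set X)
  cons : ∀ s ∈ sets, IsCons B s
  inter_mem : ∀ s ∈ sets, ∀ t ∈ sets, s ∩ t ∈ sets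
  not_empty_mem : (∅ : Set X) ∉ sets
  maximal : ∀ q : Set (Set X), (∀ s ∈ q, IsCons B s) →
    (∀ s ∈ q, ∀ t ∈ q, s ∩ t ∈ q) → (∅ : Set X) ∉ q → sets ⊆ q → q ⊆ sets

/-- For a constructible set `b`, the set `b̃ = {p ∈ X̃ : b ∈ p}`. -/
def tilde {X : Type*} (B : Set (Set X)) (b : Set X) : Set (UltraCons B) :=
  {p | b ∈ p.sets}

/-- The spectral topology on `X̃`: generated by the sets `b̃` with `b` an open
constructible subset of `X`. -/
instance ultraConsTopology {X : Type*} [TopologicalSpace X] (B : Set (Set X)) :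
    TopologicalSpace (UltraCons B) :=
  generateFrom {S | ∃ b : Set X, IsCons B b ∧ IsOpen b ∧ S = tilde B b}

/-- `(X, B)` is constructibly normal: any pair of disjoint closed constructible subsets
of `X` can be separated by disjoint open constructible subsets of `X`. -/
def ConstructiblyNormal {X : Type*} [TopologicalSpace X] (B : Set (Set X)) : Prop :=
  ∀ s t : Set X, IsCons B s → IsCons B t → IsClosed s → IsClosed t → Disjoint s t →
    ∃ u v : Set X, IsCons B u ∧ IsCons B v ∧ IsOpen u ∧ IsOpen v ∧
      s ⊆ u ∧ t ⊆ v ∧ Disjoint u v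

theorem uc_univ {X : Type*} [Nonempty X] {B : Set (Set X)} (p : UltraCons B) :
    (Set.univ : Set X) ∈ p.sets := by
  refine p.maximal (insert Set.univ p.sets) ?_ ?_ ?_ (Set.subset_insert _ _) (Set.mem_insert _ _)
  · rintro s (rfl | hs)
    · exact IsCons.univ
    · exact p.cons s hs
  · rintro s (rfl | hs) t (rfl | ht)
    · left; simp
    · right; simpa using ht
    · right; simpa using hs
    · right; exact p.inter_mem s hs t ht
  · rintro (h | h)
    · exact Set.empty_ne_univ h
    · exact p.not_empty_mem h

theorem uc_mem {X : Type*} [Nonempty X] {B : Set (Set X)} (p : UltraCons B) (s : Set X)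
    (hs : IsCons B s) (h : ∀ t ∈ p.sets, (t ∩ s).Nonempty) : s ∈ p.sets := by
  refine p.maximal {r | r ∈ p.sets ∨ ∃ t ∈ p.sets, r = t ∩ s} ?_ ?_ ?_ (fun t ht => Or.inl ht)
    (Or.inr ⟨Set.univ, uc_univ p, by simp⟩)
  · rintro r (hr | ⟨t, ht, rfl⟩)
    · exact p.cons r hr
    · exact IsCons.inter _ _ (p.cons t ht) hs
  · rintro r (hr | ⟨t, ht, rfl⟩) r' (hr' | ⟨t', ht', rfl⟩)
    · exact Or.inl (p.inter_mem _ hr _ hr')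
    · exact Or.inr ⟨r ∩ t', p.inter_mem _ hr _ ht', by grind⟩
    · exact Or.inr ⟨t ∩ r', p.inter_mem _ ht _ hr', by grind⟩
    · exact Or.inr ⟨t ∩ t', p.inter_mem _ ht _ ht', by grind⟩
  · rintro (h' | ⟨t, ht, h'⟩)
    · exact p.not_empty_mem h'
    · exact (h t ht).ne_empty h'.symm

theorem uc_upward {X : Type*} [Nonempty X] {B : Set (Set X)} (p : UltraCons B) (r s : Set X)
    (hr : r ∈ p.sets) (hrs : r ⊆ s) (hs : IsCons B s) : s ∈ p.sets := by
  refine uc_mem p s hs fun t ht => ?_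
  rw [Set.nonempty_iff_ne_empty]
  intro h
  have h2 : t ∩ r = ∅ := by
    apply Set.subset_empty_iff.1
    rw [← h]
    exact Set.inter_subset_inter_right t hrs
  exact p.not_empty_mem (h2 ▸ p.inter_mem t ht r hr)

theorem uc_compl {X : Type*} [Nonempty X] {B : Set (Set X)} (p : UltraCons B) (s : Set X)
    (hs : IsCons B s) (h : s ∉ p.sets) : sᶜ ∈ p.sets := by
  refine uc_mem p _ hs.compl fun t ht => ?_
  rw [Set.nonempty_iff_ne_empty]
  intro h'
  refine h (uc_upward p t s ht ?_ hs)
  intro x hx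
  by_contra hxs
  exact (h' ▸ (⟨hx, hxs⟩ : x ∈ t ∩ sᶜ) : x ∈ (∅ : Set X))

theorem uc_basis {X : Type*} [TopologicalSpace X] [Nonempty X] {B : Set (Set X)}
    (U : Set (UltraCons B)) (hU : IsOpen U) : ∀ p ∈ U,
    ∃ b : Set X, IsCons B b ∧ IsOpen b ∧ b ∈ p.sets ∧ tilde B b ⊆ U := by
  induction hU with
  | basic s hs =>
    obtain ⟨b, hb, hbo, rfl⟩ := hs
    exact fun p hp => ⟨b, hb, hbo, hp, subset_rfl⟩
  | univ => exact fun p _ => ⟨Set.univ, IsCons.univ, isOpen_univ, uc_univ p, Set.subset_univ _⟩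
  | inter s t _ _ ihs iht =>
    intro p hp
    obtain ⟨b, hb, hbo, hbp, hbs⟩ := ihs p hp.1
    obtain ⟨c, hc, hco, hcp, hcs⟩ := iht p hp.2
    refine ⟨b ∩ c, hb.inter _ _ hc, hbo.inter hco, p.inter_mem _ hbp _ hcp, fun q hq => ⟨?_, ?_⟩⟩
    · exact hbs (uc_upward q _ _ hq Set.inter_subset_left hb)
    · exact hcs (uc_upward q _ _ hq Set.inter_subset_right hc)
  | sUnion S _ ih =>
    rintro p ⟨s, hs, hp⟩
    obtain ⟨b, hb, hbo, hbp, hbs⟩ := ih s hs p hp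
    exact ⟨b, hb, hbo, hbp, hbs.trans (Set.subset_sUnion_of_mem hs)⟩

def ucOf {X : Type*} (B : Set (Set X)) (f : Ultrafilter X) : UltraCons B where
  sets := {s | IsCons B s ∧ s ∈ f}
  cons := fun s hs => hs.1
  inter_mem := fun s hs t ht => ⟨hs.1.inter _ _ ht.1, Filter.inter_mem hs.2 ht.2⟩
  not_empty_mem := fun h => f.empty_notMem h.2
  maximal := by
    intro q hq hi he hsub s hs
    refine ⟨hq s hs, ?_⟩
    by_contra h
    have h1 : sᶜ ∈ q := hsub ⟨(hq s hs).compl, Ultrafilter.compl_mem_iff_notMem.2 h⟩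
    have h2 := hi s hs _ h1
    rw [Set.inter_compl_self] at h2
    exact he h2

/-- If `p` contains every closed constructible set whose tilde contains `C`, then `p ∈ C`. -/
theorem uc_mem_closed {X : Type*} [TopologicalSpace X] [Nonempty X] {B : Set (Set X)}
    (C : Set (UltraCons B)) (hC : IsClosed C) (p : UltraCons B)
    (h : ∀ c, IsCons B c → IsClosed c → C ⊆ tilde B c → c ∈ p.sets) : p ∈ C := by
  by_contra hp
  obtain ⟨b, hb, hbo, hbp, hbs⟩ := uc_basis Cᶜ hC.isOpen_compl p hp
  have h1 := h bᶜ hb.compl hbo.isClosed_compl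
    (fun q hq => uc_compl q b hb fun hbq => hbs hbq hq)
  have h2 := p.inter_mem _ hbp _ h1
  rw [Set.inter_compl_self] at h2
  exact p.not_empty_mem h2

def ucFilter {X : Type*} [TopologicalSpace X] [Nonempty X] {B : Set (Set X)}
    (C : Set (UltraCons B)) : Filter X where
  sets := {s | ∃ c, IsCons B c ∧ IsClosed c ∧ C ⊆ tilde B c ∧ c ⊆ s}
  univ_sets := ⟨Set.univ, IsCons.univ, isClosed_univ, fun p _ => uc_univ p, subset_rfl⟩
  sets_of_superset := by
    rintro s t ⟨c, h1, h2, h3, h4⟩ hst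
    exact ⟨c, h1, h2, h3, h4.trans hst⟩
  inter_sets := by
    rintro s t ⟨c, h1, h2, h3, h4⟩ ⟨d, g1, g2, g3, g4⟩
    exact ⟨c ∩ d, h1.inter _ _ g1, h2.inter g2,
      fun p hp => p.inter_mem _ (h3 hp) _ (g3 hp), Set.inter_subset_inter h4 g4⟩

/-!
Statement 3: if `(X, B)` is constructibly normal, then `X̃` is a normal topological space
(not necessarily Hausdorff).
-/

theorem stmt_3 {X : Type*} [TopologicalSpace X] (B : Set (Set X))
    (hB : IsTopologicalBasis B) (hBinter : ∀ s ∈ B, ∀ t ∈ B, s ∩ t ∈ B)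
    (hN : ConstructiblyNormal B) :
    NormalSpace (UltraCons B) := by
  refine ⟨fun C D hC hD hCD => ?_⟩
  rcases isEmpty_or_nonempty X with hX | hX
  · have hsub : ∀ p q : UltraCons B, p = q := by
      have h0 : ∀ p : UltraCons B, p.sets = ∅ := by
        intro p
        refine Set.eq_empty_of_forall_notMem fun s hs => p.not_empty_mem ?_
        rwa [Set.eq_empty_of_isEmpty s] at hs
      rintro p q
      have hp := h0 p
      have hq := h0 q
      cases p; cases q
      simp_all
    rcases C.eq_empty_or_nonempty with rfl | ⟨p, hp⟩
    · exact ⟨∅, Set.univ, isOpen_empty, isOpen_univ, subset_rfl, Set.subset_univ _, by simp⟩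
    · refine ⟨Set.univ, ∅, isOpen_univ, isOpen_empty, Set.subset_univ _, ?_, by simp⟩
      intro q hq
      exact absurd (hsub p q ▸ hq) (Set.disjoint_left.1 hCD hp)
  · have key : ¬ (ucFilter C ⊓ ucFilter D).NeBot := by
      intro hne
      have hle : (Ultrafilter.of (ucFilter C ⊓ ucFilter D) : Filter X) ≤ _ := Ultrafilter.of_le _
      refine Set.disjoint_left.1 hCD
        (uc_mem_closed C hC (ucOf B (Ultrafilter.of (ucFilter C ⊓ ucFilter D))) ?_)
        (uc_mem_closed D hD _ ?_)
      · intro c h1 h2 h3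
        exact ⟨h1, (hle.trans inf_le_left) ⟨c, h1, h2, h3, subset_rfl⟩⟩
      · intro c h1 h2 h3
        exact ⟨h1, (hle.trans inf_le_right) ⟨c, h1, h2, h3, subset_rfl⟩⟩
    rw [Filter.not_neBot, ← disjoint_iff, Filter.disjoint_iff] at key
    obtain ⟨s, ⟨c, c1, c2, c3, c4⟩, t, ⟨d, d1, d2, d3, d4⟩, hst⟩ := key
    obtain ⟨u, v, hu, hv, huo, hvo, hcu, hdv, huv⟩ := hN c d c1 d1 c2 d2 (hst.mono c4 d4)
    refine ⟨tilde B u, tilde B v, isOpen_generateFrom_of_mem ⟨u, hu, huo, rfl⟩,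
      isOpen_generateFrom_of_mem ⟨v, hv, hvo, rfl⟩,
      fun p hp => uc_upward p _ _ (c3 hp) hcu hu, fun p hp => uc_upward p _ _ (d3 hp) hdv hv, ?_⟩
    refine Set.disjoint_left.2 fun p hp hp' => p.not_empty_mem ?_
    rw [← huv.inter_eq]
    exact p.inter_mem _ hp _ hp'
end

section
/- Let X be a topological space and 𝔅 a basis of open sets of X closed under finite intersections. If x ∈ X is a closed point of X (the singleton {x} is closed) and the singleton {x} is a constructible set, then the principal ultrafilter type(x) is a closed point of X̃. -/
/-!
Statement 0: For a topological space `X` with a basis `B` of open sets closed under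
finite intersections, the space `X̃` of ultrafilters of constructible sets, with the
spectral topology, is a spectral space.
-/

open Set TopologicalSpace

/-- The principal ultrafilter `type(x) = {b constructible : x ∈ b}` of a point `x ∈ X`. -/
def typeOf {X : Type*} (B : Set (Set X)) (x : X) : UltraCons B where
  sets := {s | IsCons B s ∧ x ∈ s}
  cons := fun _ hs => hs.1
  inter_mem := fun s hs t ht => ⟨IsCons.inter s t hs.1 ht.1, hs.2, ht.2⟩
  not_empty_mem := fun h => h.2
  maximal := by
    intro q hq1 hq2 hq3 hsub s hsq
    refine ⟨hq1 s hsq, ?_⟩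
    by_contra hx
    have h1 : sᶜ ∈ {s : Set X | IsCons B s ∧ x ∈ s} := ⟨IsCons.compl s (hq1 s hsq), hx⟩
    have h2 : s ∩ sᶜ ∈ q := hq2 s hsq sᶜ (hsub h1)
    rw [Set.inter_compl_self] at h2
    exact hq3 h2
/-!
Statement 4: if `x ∈ X` is a closed point and the singleton `{x}` is constructible,
then `type(x)` is a closed point of `X̃`.
-/

theorem stmt_4 {X : Type*} [TopologicalSpace X] (B : Set (Set X))
    (hB : IsTopologicalBasis B) (hBinter : ∀ s ∈ B, ∀ t ∈ B, s ∩ t ∈ B)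
    (x : X) (hx : IsClosed ({x} : Set X)) (hxc : IsCons B ({x} : Set X)) :
    IsClosed ({typeOf B x} : Set (UltraCons B)) := by
  have hc : IsCons B ({x}ᶜ : Set X) := IsCons.compl _ hxc
  have key : ({typeOf B x} : Set (UltraCons B))ᶜ = tilde B ({x}ᶜ) := by
    ext p
    constructor
    · intro hp
      by_cases h : ∀ s ∈ p.sets, x ∈ s
      · exfalso
        apply hp
        have h1 : p.sets ⊆ (typeOf B x).sets := fun s hs => ⟨p.cons s hs, h s hs⟩
        have h2 : p.sets = (typeOf B x).sets :=
          Subset.antisymm h1 (p.maximal _ (typeOf B x).cons (typeOf B x).inter_mem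
            (typeOf B x).not_empty_mem h1)
        show p = typeOf B x
        cases p
        simp only at h2
        subst h2
        rfl
      · push Not at h
        obtain ⟨s, hs, hxs⟩ := h
        refine p.maximal {u | IsCons B u ∧ ∃ t ∈ p.sets, t ⊆ u} (fun u hu => hu.1) ?_ ?_ ?_ ?_
        · rintro u ⟨hu, t, ht, htu⟩ v ⟨hv, r, hr, hrv⟩
          exact ⟨IsCons.inter u v hu hv, t ∩ r, p.inter_mem t ht r hr, inter_subset_inter htu hrv⟩
        · rintro ⟨_, t, ht, hte⟩
          rw [subset_empty_iff] at hte
          exact p.not_empty_mem (hte ▸ ht)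
        · exact fun u hu => ⟨p.cons u hu, u, hu, Subset.rfl⟩
        · refine ⟨hc, s, hs, ?_⟩
          intro y hy hyx
          rw [mem_singleton_iff] at hyx
          exact hxs (hyx ▸ hy)
    · intro hp hpe
      rw [mem_singleton_iff] at hpe
      subst hpe
      exact hp.2 rfl
  rw [← isOpen_compl_iff, key]
  exact isOpen_generateFrom_of_mem ⟨_, hc, hx.isOpen_compl, rfl⟩
end

section
/- Let X = ℚ with the order topology and let 𝔅 be the basis consisting of the open intervals (a,b) ⊆ ℚ with a ∈ ℚ ∪ {-∞} and b ∈ ℚ ∪ {+∞} (together with the empty set). Then the subspace X̃^max of closed points of X̃ is homeomorphic to the extended real line [-∞,+∞], by a homeomorphism whose composition with the embedding x ↦ type(x) of ℚ into X̃^max is the natural inclusion of ℚ into [-∞,+∞]. -/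
/-!
Statement 0: For a topological space `X` with a basis `B` of open sets closed under
finite intersections, the space `X̃` of ultrafilters of constructible sets, with the
spectral topology, is a spectral space.
-/

open Set TopologicalSpace

/-- The basis of the order topology on `ℚ` consisting of all open intervals `(a, b)` with
`a ∈ ℚ ∪ {-∞}` and `b ∈ ℚ ∪ {+∞}` (together with the empty set). -/
def ratIntervals : Set (Set ℚ) :=
  {S | S = ∅ ∨ S = Set.univ ∨ (∃ a b : ℚ, S = Set.Ioo a b) ∨
    (∃ a : ℚ, S = Set.Ioi a) ∨ (∃ b : ℚ, S = Set.Iio b)}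


open Filter Topology

namespace S6

abbrev P := UltraCons ratIntervals

noncomputable def c (q : ℚ) : EReal := ((q : ℝ) : EReal)

lemma c_lt {a b : ℚ} : c a < c b ↔ a < b := by simp [c]

lemma c_emb : IsEmbedding c := EReal.isEmbedding_coe.comp Rat.isEmbedding_coe_real

lemma btwn {a b : EReal} (h : a < b) : ∃ q : ℚ, a < c q ∧ c q < b := by
  obtain ⟨q, h1, h2⟩ := EReal.lt_iff_exists_rat_btwn.1 h
  exact ⟨q, h1, h2⟩

lemma cIoi (a : ℚ) : IsCons ratIntervals (Ioi a) :=
  IsCons.basic _ (Or.inr (Or.inr (Or.inr (Or.inl ⟨a, rfl⟩))))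

lemma cIio (a : ℚ) : IsCons ratIntervals (Iio a) :=
  IsCons.basic _ (Or.inr (Or.inr (Or.inr (Or.inr ⟨a, rfl⟩))))

lemma sup_mem (p : P) {u v : Set ℚ} (hu : u ∈ p.sets) (huv : u ⊆ v)
    (hv : IsCons ratIntervals v) : v ∈ p.sets := by
  refine p.maximal {v | IsCons ratIntervals v ∧ ∃ u ∈ p.sets, u ⊆ v} (fun s h => h.1) ?_ ?_ ?_
    ⟨hv, u, hu, huv⟩
  · rintro s ⟨hs, u, hu, hus⟩ t ⟨ht, w, hw, hwt⟩
    exact ⟨hs.inter _ _ ht, u ∩ w, p.inter_mem _ hu _ hw, inter_subset_inter hus hwt⟩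
  · rintro ⟨-, u, hu, h⟩
    rw [subset_empty_iff.1 h] at hu
    exact p.not_empty_mem hu
  · intro s hs
    exact ⟨p.cons s hs, s, hs, subset_rfl⟩

lemma univ_mem (p : P) : (univ : Set ℚ) ∈ p.sets := by
  refine p.maximal (insert univ p.sets) ?_ ?_ ?_ (subset_insert _ _) (mem_insert _ _)
  · rintro s (rfl | hs)
    · exact IsCons.univ
    · exact p.cons s hs
  · rintro s (rfl | hs) t (rfl | ht)
    · simp
    · simp [ht]
    · simp [hs]
    · exact Or.inr (p.inter_mem _ hs _ ht)
  · rintro (h | h)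
    · exact empty_ne_univ h
    · exact p.not_empty_mem h

lemma compl_mem (p : P) {s : Set ℚ} (hs : IsCons ratIntervals s) (h : s ∉ p.sets) :
    sᶜ ∈ p.sets := by
  by_contra hc
  apply h
  refine p.maximal {v | IsCons ratIntervals v ∧ ∃ u ∈ p.sets, s ∩ u ⊆ v} (fun s h => h.1) ?_ ?_ ?_
    ⟨hs, univ, univ_mem p, inter_subset_left⟩
  · rintro a ⟨ha, u, hu, hus⟩ t ⟨ht, w, hw, hwt⟩
    exact ⟨ha.inter _ _ ht, u ∩ w, p.inter_mem _ hu _ hw, fun x hx =>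
      ⟨hus ⟨hx.1, hx.2.1⟩, hwt ⟨hx.1, hx.2.2⟩⟩⟩
  · rintro ⟨-, u, hu, h⟩
    exact hc (sup_mem p hu (fun x hx hxs => h ⟨hxs, hx⟩) (hs.compl))
  · intro a ha
    exact ⟨p.cons a ha, a, ha, inter_subset_right⟩

lemma ext_of_sub {p q : P} (h : p.sets ⊆ q.sets) : p = q := by
  have h2 := p.maximal q.sets q.cons q.inter_mem q.not_empty_mem h
  have h3 := subset_antisymm h h2
  cases p; cases q; cases h3; rfl

noncomputable def f (p : P) : EReal := sSup {r | ∃ q : ℚ, Ioi q ∈ p.sets ∧ c q = r}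

lemma le_f {p : P} {q : ℚ} (h : Ioi q ∈ p.sets) : c q ≤ f p := le_sSup ⟨q, h, rfl⟩

lemma f_le {p : P} {q : ℚ} (h : Iio q ∈ p.sets) : f p ≤ c q := by
  refine sSup_le ?_
  rintro _ ⟨a, ha, rfl⟩
  by_contra hlt
  have hlt := c_lt.1 (not_le.1 hlt)
  apply p.not_empty_mem
  have := p.inter_mem _ h _ ha
  convert this
  ext x
  simp only [mem_empty_iff_false, mem_inter_iff, mem_Iio, mem_Ioi, false_iff, not_and, not_lt]
  intro hx
  exact (hx.trans hlt).le

lemma mem_Ioi_of {p : P} {q : ℚ} (h : c q < f p) : Ioi q ∈ p.sets := by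
  obtain ⟨_, ⟨a, ha, rfl⟩, hq⟩ := lt_sSup_iff.1 h
  exact sup_mem p ha (Ioi_subset_Ioi (c_lt.1 hq).le) (cIoi q)

lemma mem_Iio_of {p : P} {q : ℚ} (h : f p < c q) : Iio q ∈ p.sets := by
  obtain ⟨a, ha, hq⟩ := btwn h
  have h1 : Ioi a ∉ p.sets := fun h => absurd (le_f h) (not_le.2 ha)
  refine sup_mem p (compl_mem p (cIoi a) h1) ?_ (cIio q)
  intro x hx
  simp only [mem_compl_iff, mem_Ioi, not_lt] at hx
  exact lt_of_le_of_lt hx (c_lt.1 hq)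

lemma tilde_open {b : Set ℚ} (hb : IsCons ratIntervals b) (ho : IsOpen b) :
    IsOpen (tilde ratIntervals b) := isOpen_generateFrom_of_mem ⟨b, hb, ho, rfl⟩

lemma f_cont : Continuous f := by
  rw [OrderTopology.topology_eq_generate_intervals (α := EReal), continuous_generateFrom_iff]
  rintro _ ⟨r, rfl | rfl⟩
  · have : f ⁻¹' Ioi r = ⋃ q : ℚ, ⋃ _ : r < c q, tilde ratIntervals (Ioi q) := by
      ext p
      simp only [mem_preimage, mem_Ioi, mem_iUnion, exists_prop]
      constructor
      · intro h
        obtain ⟨q, h1, h2⟩ := btwn h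
        exact ⟨q, h1, mem_Ioi_of h2⟩
      · rintro ⟨q, h1, h2⟩
        exact h1.trans_le (le_f h2)
    rw [this]
    exact isOpen_iUnion fun q => isOpen_iUnion fun _ => tilde_open (cIoi q) isOpen_Ioi
  · have : f ⁻¹' Iio r = ⋃ q : ℚ, ⋃ _ : c q < r, tilde ratIntervals (Iio q) := by
      ext p
      simp only [mem_preimage, mem_Iio, mem_iUnion, exists_prop]
      constructor
      · intro h
        obtain ⟨q, h1, h2⟩ := btwn h
        exact ⟨q, h2, mem_Iio_of h1⟩
      · rintro ⟨q, h1, h2⟩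
        exact (f_le h2).trans_lt h1
    rw [this]
    exact isOpen_iUnion fun q => isOpen_iUnion fun _ => tilde_open (cIio q) isOpen_Iio

/-- Neighbourhood sets of the cut belong to the ultrafilter. -/
lemma mem_of_nhds {p : P} {s : Set ℚ} (hs : IsCons ratIntervals s)
    (h : s ∈ comap c (𝓝 (f p))) : s ∈ p.sets := by
  obtain ⟨U, hU, hUs⟩ := mem_comap.1 h
  have key : ∃ l ∈ p.sets, ∃ u ∈ p.sets, l ∩ u ⊆ s := by
    have hl : ∃ l ∈ p.sets, ∀ x ∈ l, f p ≤ c x ∨ ∀ y, c x ≤ y → y ≤ f p → y ∈ U := by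
      by_cases hb : f p = ⊥
      · exact ⟨univ, univ_mem p, fun x _ => Or.inl (by simp [hb])⟩
      · obtain ⟨a, ha, haU⟩ := exists_Ioc_subset_of_mem_nhds hU ⟨⊥, bot_lt_iff_ne_bot.2 hb⟩
        obtain ⟨q, h1, h2⟩ := btwn ha
        exact ⟨Ioi q, mem_Ioi_of h2, fun x hx => Or.inr fun y hy hy2 =>
          haU ⟨h1.trans ((c_lt.2 hx).trans_le hy), hy2⟩⟩
    have hu : ∃ l ∈ p.sets, ∀ x ∈ l, c x ≤ f p ∨ ∀ y, y ≤ c x → f p ≤ y → y ∈ U := by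
      by_cases hb : f p = ⊤
      · exact ⟨univ, univ_mem p, fun x _ => Or.inl (by simp [hb])⟩
      · obtain ⟨a, ha, haU⟩ := exists_Ico_subset_of_mem_nhds hU ⟨⊤, lt_top_iff_ne_top.2 hb⟩
        obtain ⟨q, h1, h2⟩ := btwn ha
        exact ⟨Iio q, mem_Iio_of h1, fun x hx => Or.inr fun y hy hy2 =>
          haU ⟨hy2, (hy.trans_lt (c_lt.2 hx)).trans h2⟩⟩
    obtain ⟨l, hl, hl2⟩ := hl
    obtain ⟨u, hu, hu2⟩ := hu
    refine ⟨l, hl, u, hu, fun x hx => hUs ?_⟩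
    show c x ∈ U
    rcases le_total (c x) (f p) with h | h
    · rcases hl2 x hx.1 with h' | h'
      · rw [le_antisymm h h']; exact mem_of_mem_nhds hU
      · exact h' _ le_rfl h
    · rcases hu2 x hx.2 with h' | h'
      · rw [le_antisymm h' h]; exact mem_of_mem_nhds hU
      · exact h' _ le_rfl h
  obtain ⟨l, hl, u, hu, hs'⟩ := key
  exact sup_mem p (p.inter_mem _ hl _ hu) hs' hs

open Classical in
noncomputable def G (r : EReal) : Filter ℚ :=
  if ∃ q, c q = r then comap c (pure r) else comap c (𝓝 r)

lemma G_rat (q : ℚ) : G (c q) = pure q := by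
  rw [G, if_pos ⟨q, rfl⟩, ← map_pure, comap_map c_emb.injective]

lemma G_irr {r : EReal} (h : ¬ ∃ q, c q = r) : G r = comap c (𝓝 r) := if_neg h

lemma G_le (r : EReal) : G r ≤ comap c (𝓝 r) := by
  rw [G]; split_ifs
  · exact comap_mono (pure_le_nhds r)
  · exact le_rfl

lemma c_dense : DenseRange c := by
  refine dense_of_exists_between ?_
  intro a b h
  obtain ⟨q, h1, h2⟩ := btwn h
  exact ⟨c q, ⟨q, rfl⟩, h1, h2⟩

lemma G_neBot (r : EReal) : (G r).NeBot := by
  by_cases h : ∃ q, c q = r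
  · obtain ⟨q, rfl⟩ := h
    rw [G_rat]; infer_instance
  · rw [G_irr h]
    rw [comap_neBot_iff]
    intro t ht
    obtain ⟨q, hq⟩ := c_dense.exists_mem_open isOpen_interior ⟨r, mem_interior_iff_mem_nhds.2 ht⟩
    exact ⟨q, interior_subset hq⟩

lemma open_mem_G {b : Set ℚ} (ho : IsOpen b) (r : EReal) : b ∈ G r ↔ b ∈ comap c (𝓝 r) := by
  refine ⟨fun h => ?_, fun h => G_le r h⟩
  by_cases hr : ∃ q, c q = r
  · obtain ⟨q, rfl⟩ := hr
    rw [G_rat] at h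
    rw [← c_emb.nhds_eq_comap]
    exact ho.mem_nhds h
  · rwa [← G_irr hr]

lemma Ioi_G {a : ℚ} {r : EReal} (h : c a < r) : Ioi a ∈ G r := by
  refine G_le r (mem_comap.2 ⟨_, Ioi_mem_nhds h, fun x hx => c_lt.1 hx⟩)

lemma Iio_G {a : ℚ} {r : EReal} (h : r < c a) : Iio a ∈ G r := by
  refine G_le r (mem_comap.2 ⟨_, Iio_mem_nhds h, fun x hx => c_lt.1 hx⟩)

lemma inter_dec {l : Filter ℚ} {s t : Set ℚ} (hs : s ∈ l ∨ sᶜ ∈ l) (ht : t ∈ l ∨ tᶜ ∈ l) :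
    s ∩ t ∈ l ∨ (s ∩ t)ᶜ ∈ l := by
  rcases hs with hs | hs
  · rcases ht with ht | ht
    · exact Or.inl (inter_mem hs ht)
    · exact Or.inr (mem_of_superset ht (compl_subset_compl.2 inter_subset_right))
  · exact Or.inr (mem_of_superset hs (compl_subset_compl.2 inter_subset_left))

lemma G_dec (r : EReal) {s : Set ℚ} (hs : IsCons ratIntervals s) : s ∈ G r ∨ sᶜ ∈ G r := by
  by_cases h : ∃ q, c q = r
  · obtain ⟨q, rfl⟩ := h
    rw [G_rat]
    exact em (q ∈ s)
  have hi : ∀ a : ℚ, Ioi a ∈ G r ∨ (Ioi a)ᶜ ∈ G r := by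
    intro a
    rcases lt_trichotomy (c a) r with h1 | h1 | h1
    · exact Or.inl (Ioi_G h1)
    · exact absurd ⟨a, h1⟩ h
    · exact Or.inr (mem_of_superset (Iio_G h1) fun x hx hx2 => lt_asymm (mem_Ioi.1 ‹_›) (mem_Iio.1 ‹_›))
  have hj : ∀ a : ℚ, Iio a ∈ G r ∨ (Iio a)ᶜ ∈ G r := by
    intro a
    rcases lt_trichotomy (c a) r with h1 | h1 | h1
    · exact Or.inr (mem_of_superset (Ioi_G h1) fun x hx hx2 => lt_asymm (mem_Ioi.1 ‹_›) (mem_Iio.1 ‹_›))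
    · exact absurd ⟨a, h1⟩ h
    · exact Or.inl (Iio_G h1)
  induction hs with
  | basic s hs =>
    rcases hs with rfl | rfl | ⟨a, b, rfl⟩ | ⟨a, rfl⟩ | ⟨b, rfl⟩
    · right; simp
    · left; simp
    · exact inter_dec (hi a) (hj b)
    · exact hi a
    · exact hj b
  | univ => left; simp
  | compl s hs ih => rw [compl_compl]; exact ih.symm
  | inter s t hs ht ih1 ih2 => exact inter_dec ih1 ih2

noncomputable def g (r : EReal) : P where
  sets := {s | IsCons ratIntervals s ∧ s ∈ G r}
  cons := fun _ hs => hs.1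
  inter_mem := fun s hs t ht => ⟨IsCons.inter s t hs.1 ht.1, Filter.inter_mem hs.2 ht.2⟩
  not_empty_mem := fun h => (G_neBot r).ne (Filter.empty_mem_iff_bot.1 h.2)
  maximal := by
    intro q hq1 hq2 hq3 hsub s hsq
    refine ⟨hq1 s hsq, ?_⟩
    rcases G_dec r (hq1 s hsq) with h | h
    · exact h
    · have h2 : s ∩ sᶜ ∈ q := hq2 s hsq sᶜ (hsub ⟨(hq1 s hsq).compl, h⟩)
      rw [Set.inter_compl_self] at h2
      exact absurd h2 hq3

lemma f_g (r : EReal) : f (g r) = r := by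
  apply le_antisymm
  · by_contra h
    obtain ⟨q, h1, h2⟩ := btwn (not_le.1 h)
    exact absurd (f_le (p := g r) ⟨cIio q, Iio_G h1⟩) (not_le.2 h2)
  · by_contra h
    obtain ⟨q, h1, h2⟩ := btwn (not_le.1 h)
    exact absurd (le_f (p := g r) ⟨cIoi q, Ioi_G h2⟩) (not_le.2 h1)

lemma g_cont : Continuous g := by
  refine continuous_generateFrom_iff.2 ?_
  rintro _ ⟨b, hb, ho, rfl⟩
  rw [isOpen_iff_mem_nhds]
  intro r hr
  have hr : b ∈ comap c (𝓝 r) := (open_mem_G ho r).1 hr.2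
  obtain ⟨U, hU, hUb⟩ := mem_comap.1 hr
  filter_upwards [eventually_mem_nhds_iff.2 hU] with y hy
  exact ⟨hb, (open_mem_G ho y).2 (mem_comap.2 ⟨U, hy, hUb⟩)⟩

lemma g_closed (r : EReal) : IsClosed ({g r} : Set P) := by
  refine isClosed_of_closure_subset ?_
  intro p hp
  have hfp : f p = r := by
    have : closure {g r} ⊆ f ⁻¹' {r} :=
      closure_minimal (by simp [f_g]) (isClosed_singleton.preimage f_cont)
    exact this hp
  have hopen : ∀ b, IsCons ratIntervals b → IsOpen b → b ∈ p.sets → b ∈ G r := by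
    intro b hb ho hbp
    obtain ⟨y, hy, rfl⟩ := mem_closure_iff.1 hp _ (tilde_open hb ho) hbp
    exact hy.2
  refine mem_singleton_iff.2 (Eq.symm ?_)
  apply ext_of_sub
  rintro s ⟨hs, hsG⟩
  by_cases h : ∃ q, c q = r
  · obtain ⟨q, rfl⟩ := h
    rw [G_rat] at hopen hsG
    have h1 : Ioi q ∉ p.sets := fun h => lt_irrefl q (hopen _ (cIoi q) isOpen_Ioi h)
    have h2 : Iio q ∉ p.sets := fun h => lt_irrefl q (hopen _ (cIio q) isOpen_Iio h)
    refine sup_mem p (p.inter_mem _ (compl_mem p (cIoi q) h1) _ (compl_mem p (cIio q) h2)) ?_ hs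
    rintro x ⟨hx1, hx2⟩
    rw [mem_compl_iff, mem_Ioi, not_lt] at hx1
    rw [mem_compl_iff, mem_Iio, not_lt] at hx2
    rw [le_antisymm hx1 hx2]
    exact hsG
  · rw [G_irr h, ← hfp] at hsG
    exact mem_of_nhds hs hsG

lemma g_f (p : P) (hp : IsClosed ({p} : Set P)) : g (f p) = p := by
  by_contra hne
  have h1 : ({p} : Set P)ᶜ ∈ 𝓝 (g (f p)) := hp.isOpen_compl.mem_nhds hne
  have hle : pure p ≤ 𝓝 (g (f p)) := by
    rw [nhds_generateFrom]
    refine le_iInf₂ ?_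
    rintro _ ⟨hm, b, hb, ho, rfl⟩
    rw [le_principal_iff]
    exact mem_of_nhds hb ((open_mem_G ho _).1 hm.2)
  exact hle h1 rfl

lemma g_rat (q : ℚ) : typeOf ratIntervals q = g (c q) := by
  apply ext_of_sub
  rintro s ⟨hs, hq⟩
  refine ⟨hs, ?_⟩
  rw [G_rat]
  exact hq

end S6

/-!
Statement 6: for `X = ℚ` with this basis, the subspace `X̃^max` of closed points of `X̃` is
homeomorphic to the extended real line `[-∞, +∞]`, by a homeomorphism whose composition
with `x ↦ type(x)` is the natural inclusion of `ℚ` into `[-∞, +∞]`.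
-/

theorem stmt_6 :
    ∃ (e : {p : UltraCons ratIntervals // IsClosed ({p} : Set (UltraCons ratIntervals))} ≃ₜ EReal)
      (h : ∀ x : ℚ, IsClosed ({typeOf ratIntervals x} : Set (UltraCons ratIntervals))),
      ∀ x : ℚ, e ⟨typeOf ratIntervals x, h x⟩ = ((x : ℝ) : EReal) := by
  refine ⟨{ toFun := fun p => S6.f p.1
            invFun := fun r => ⟨S6.g r, S6.g_closed r⟩
            left_inv := fun p => Subtype.ext (S6.g_f p.1 p.2)
            right_inv := S6.f_g
            continuous_toFun := S6.f_cont.comp continuous_subtype_val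
            continuous_invFun := S6.g_cont.subtype_mk _ }, ?_, ?_⟩
  · intro x
    rw [S6.g_rat]
    exact S6.g_closed _
  · intro x
    show S6.f (typeOf ratIntervals x) = _
    rw [S6.g_rat, S6.f_g]
    rfl
end

section
/- Let X = ℚ with the order topology and let 𝔅 be the basis consisting of the bounded open intervals (a,b) ⊆ ℚ with a,b ∈ ℚ (together with the empty set). Then the subspace X̃^max of closed points of X̃ is homeomorphic to the one-point compactification ℝ ∪ {∞} of the real line, by a homeomorphism whose composition with the embedding x ↦ type(x) of ℚ into X̃^max is the natural inclusion of ℚ into ℝ ∪ {∞}. -/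
/-!
Statement 0: For a topological space `X` with a basis `B` of open sets closed under
finite intersections, the space `X̃` of ultrafilters of constructible sets, with the
spectral topology, is a spectral space.
-/

open Set TopologicalSpace

/-- The basis of the order topology on `ℚ` consisting of all bounded open intervals
`(a, b)` with `a, b ∈ ℚ` (together with the empty set). -/
def ratBddIntervals : Set (Set ℚ) :=
  {S | S = ∅ ∨ ∃ a b : ℚ, S = Set.Ioo a b}

/-!
Statement 7: for `X = ℚ` with the basis of bounded open intervals, the subspace `X̃^max` of
closed points of `X̃` is homeomorphic to the one-point compactification `ℝ ∪ {∞}` of the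
real line, by a homeomorphism whose composition with `x ↦ type(x)` is the natural
inclusion of `ℚ` into `ℝ ∪ {∞}`.
-/

section Helpers

open Filter Topology

variable {X : Type*} {B : Set (Set X)}

theorem UC.univ_mem [Nonempty X] (p : UltraCons B) : univ ∈ p.sets := by
  refine p.maximal (p.sets ∪ {univ}) ?_ ?_ ?_ subset_union_left (Or.inr rfl)
  · rintro u (hu | rfl)
    · exact p.cons u hu
    · exact IsCons.univ
  · rintro u (hu | rfl) v (hv | rfl)
    · exact Or.inl (p.inter_mem u hu v hv)
    · rw [inter_univ]; exact Or.inl hu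
    · rw [univ_inter]; exact Or.inl hv
    · rw [univ_inter]; exact Or.inr rfl
  · rintro (hu | hu)
    · exact p.not_empty_mem hu
    · exact empty_ne_univ hu

theorem UC.mem_of [Nonempty X] (p : UltraCons B) {s : Set X} (hs : IsCons B s)
    (h : ∀ t ∈ p.sets, (s ∩ t).Nonempty) : s ∈ p.sets := by
  refine p.maximal (p.sets ∪ {u | ∃ t ∈ p.sets, u = s ∩ t}) ?_ ?_ ?_
    subset_union_left (Or.inr ⟨univ, UC.univ_mem p, by simp⟩)
  · rintro u (hu | ⟨t, ht, rfl⟩)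
    · exact p.cons u hu
    · exact IsCons.inter _ _ hs (p.cons t ht)
  · rintro u (hu | ⟨t, ht, rfl⟩) v (hv | ⟨t', ht', rfl⟩)
    · exact Or.inl (p.inter_mem u hu v hv)
    · exact Or.inr ⟨u ∩ t', p.inter_mem _ hu _ ht', by ac_rfl⟩
    · exact Or.inr ⟨t ∩ v, p.inter_mem _ ht _ hv, by ac_rfl⟩
    · refine Or.inr ⟨t ∩ t', p.inter_mem _ ht _ ht', ?_⟩
      ext x; simp only [mem_inter_iff]; tauto
  · rintro (hu | ⟨t, ht, hu⟩)
    · exact p.not_empty_mem hu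
    · have := h t ht
      rw [← hu] at this
      simp at this

theorem UC.mem_or [Nonempty X] (p : UltraCons B) {s : Set X} (hs : IsCons B s) :
    s ∈ p.sets ∨ sᶜ ∈ p.sets := by
  by_contra! hh
  have h1 : ∃ t ∈ p.sets, ¬ (s ∩ t).Nonempty := by
    by_contra! h; exact hh.1 (UC.mem_of p hs h)
  have h2 : ∃ t ∈ p.sets, ¬ (sᶜ ∩ t).Nonempty := by
    by_contra! h; exact hh.2 (UC.mem_of p hs.compl h)
  obtain ⟨t, ht, h1⟩ := h1
  obtain ⟨u, hu, h2⟩ := h2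
  apply p.not_empty_mem
  convert p.inter_mem t ht u hu
  rw [not_nonempty_iff_eq_empty, eq_empty_iff_forall_notMem] at h1 h2
  symm
  rw [eq_empty_iff_forall_notMem]
  intro x hx
  by_cases hxs : x ∈ s
  · exact h1 x ⟨hxs, hx.1⟩
  · exact h2 x ⟨hxs, hx.2⟩

theorem UC.superset [Nonempty X] (p : UltraCons B) {s t : Set X} (hs : s ∈ p.sets)
    (ht : IsCons B t) (hst : s ⊆ t) : t ∈ p.sets := by
  rcases UC.mem_or p ht with h | h
  · exact h
  · exfalso
    apply p.not_empty_mem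
    convert p.inter_mem s hs _ h
    symm
    rw [eq_empty_iff_forall_notMem]
    exact fun x hx => hx.2 (hst hx.1)

theorem UC.compl_iff [Nonempty X] (p : UltraCons B) {s : Set X} (hs : IsCons B s) :
    sᶜ ∈ p.sets ↔ s ∉ p.sets := by
  constructor
  · intro h h'
    apply p.not_empty_mem
    convert p.inter_mem s h' _ h
    simp
  · intro h
    exact (UC.mem_or p hs).resolve_left h

theorem UC.ext' {p q : UltraCons B} (h : p.sets = q.sets) : p = q := by
  cases p; cases q; cases h; rfl

theorem UC.eq_of [Nonempty X] {p q : UltraCons B} (h : ∀ s ∈ B, s ∈ p.sets ↔ s ∈ q.sets) :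
    p = q := by
  have key : ∀ s, IsCons B s → (s ∈ p.sets ↔ s ∈ q.sets) := by
    intro s hs
    induction hs with
    | basic s hs => exact h s hs
    | univ => exact ⟨fun _ => UC.univ_mem q, fun _ => UC.univ_mem p⟩
    | compl s hs ih => rw [UC.compl_iff p hs, UC.compl_iff q hs, ih]
    | inter s t hs ht ihs iht =>
      constructor
      · intro h
        exact q.inter_mem _ (ihs.1 (UC.superset p h hs inter_subset_left)) _
          (iht.1 (UC.superset p h ht inter_subset_right))
      · intro h
        exact p.inter_mem _ (ihs.2 (UC.superset q h hs inter_subset_left)) _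
          (iht.2 (UC.superset q h ht inter_subset_right))
  apply UC.ext'
  ext s
  exact ⟨fun hs => (key s (p.cons s hs)).1 hs, fun hs => (key s (q.cons s hs)).2 hs⟩

/-- The ultrafilter of constructible sets attached to a filter deciding them. -/
def UC.ofFilter (F : Filter X) (hF : F.NeBot) (h : ∀ s, IsCons B s → s ∈ F ∨ sᶜ ∈ F) :
    UltraCons B where
  sets := {s | IsCons B s ∧ s ∈ F}
  cons := fun _ hs => hs.1
  inter_mem := fun s hs t ht => ⟨IsCons.inter s t hs.1 ht.1, inter_mem hs.2 ht.2⟩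
  not_empty_mem := fun h => empty_notMem F h.2
  maximal := by
    intro q hq1 hq2 hq3 hsub s hsq
    refine ⟨hq1 s hsq, ?_⟩
    by_contra hx
    have h1 : sᶜ ∈ {s : Set X | IsCons B s ∧ s ∈ F} :=
      ⟨IsCons.compl s (hq1 s hsq), (h s (hq1 s hsq)).resolve_left hx⟩
    have h2 : s ∩ sᶜ ∈ q := hq2 s hsq sᶜ (hsub h1)
    rw [Set.inter_compl_self] at h2
    exact hq3 h2

theorem cons_decide (F : Filter X) (h : ∀ s ∈ B, s ∈ F ∨ sᶜ ∈ F) :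
    ∀ s, IsCons B s → s ∈ F ∨ sᶜ ∈ F := by
  intro s hs
  induction hs with
  | basic s hs => exact h s hs
  | univ => exact Or.inl univ_mem
  | compl s hs ih => rw [compl_compl]; exact ih.symm
  | inter s t hs ht ihs iht =>
    rcases ihs with a | a
    · rcases iht with b | b
      · exact Or.inl (inter_mem a b)
      · exact Or.inr (mem_of_superset b (compl_subset_compl.2 inter_subset_right))
    · exact Or.inr (mem_of_superset a (compl_subset_compl.2 inter_subset_left))

open Classical in
/-- The filter on the reals used for a real point. -/
noncomputable def rF (r : ℝ) : Filter ℝ :=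
  if r ∈ Set.range ((↑) : ℚ → ℝ) then pure r else 𝓝 r

theorem rF_le (r : ℝ) : rF r ≤ 𝓝 r := by
  unfold rF
  split_ifs
  · exact pure_le_nhds r
  · exact le_rfl

/-- The filter on the rationals attached to a point of the compactified line. -/
noncomputable def pF : OnePoint ℝ → Filter ℚ
  | none => comap ((↑) : ℚ → ℝ) (Bornology.cobounded ℝ)
  | some r => comap ((↑) : ℚ → ℝ) (rF r)

theorem pF_infty : pF OnePoint.infty = comap ((↑) : ℚ → ℝ) (Bornology.cobounded ℝ) := rfl
theorem pF_coe (r : ℝ) : pF (r : OnePoint ℝ) = comap ((↑) : ℚ → ℝ) (rF r) := rfl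

theorem pF_rat (q : ℚ) : pF ((q : ℝ) : OnePoint ℝ) = pure q := by
  rw [pF_coe, rF, if_pos ⟨q, rfl⟩, comap_pure, ← principal_singleton]
  congr 1
  ext x; simp

theorem pF_neBot (x : OnePoint ℝ) : (pF x).NeBot := by
  induction x using OnePoint.rec with
  | infty =>
    rw [pF_infty, comap_neBot_iff]
    intro t ht
    replace ht : Bornology.IsBounded tᶜ := Bornology.isBounded_compl_iff.2 ht
    obtain ⟨M, hM⟩ := ht.subset_closedBall 0
    obtain ⟨q, hq⟩ := exists_rat_gt M
    refine ⟨q, ?_⟩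
    by_contra h
    have := hM h
    rw [mem_closedBall_zero_iff, Real.norm_eq_abs] at this
    linarith [le_abs_self (q : ℝ)]
  | coe r =>
    by_cases h : r ∈ Set.range ((↑) : ℚ → ℝ)
    · obtain ⟨q, rfl⟩ := h
      rw [pF_rat]; infer_instance
    · rw [pF_coe, rF, if_neg h, comap_neBot_iff]
      intro t ht
      obtain ⟨y, hy, q, rfl⟩ := mem_closure_iff_nhds.1 (Rat.denseRange_cast (𝕜 := ℝ) r) t ht
      exact ⟨q, hy⟩

theorem pF_basic (x : OnePoint ℝ) (s : Set ℚ) (hs : s ∈ ratBddIntervals) :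
    s ∈ pF x ∨ sᶜ ∈ pF x := by
  rcases hs with rfl | ⟨a, b, rfl⟩
  · right; simp
  induction x using OnePoint.rec with
  | infty =>
    right
    rw [pF_infty]
    refine ⟨(Ioo (a : ℝ) b)ᶜ, ?_, ?_⟩
    · exact (Metric.isBounded_Ioo (a : ℝ) b)
    · intro q hq hq'
      exact hq ⟨by exact_mod_cast hq'.1, by exact_mod_cast hq'.2⟩
  | coe r =>
    by_cases h : r ∈ Set.range ((↑) : ℚ → ℝ)
    · obtain ⟨q, rfl⟩ := h
      rw [pF_rat]; exact em _
    · rw [pF_coe, rF, if_neg h]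
      have ha : r ≠ a := fun e => h ⟨a, e.symm⟩
      have hb : r ≠ b := fun e => h ⟨b, e.symm⟩
      rcases lt_or_gt_of_ne ha with h1 | h1
      · right
        refine ⟨Iio (a : ℝ), Iio_mem_nhds h1, ?_⟩
        intro q hq hq'
        have hq : (q : ℝ) < a := hq
        have := hq'.1
        have : q < a := by exact_mod_cast hq
        linarith
      · rcases lt_or_gt_of_ne hb with h2 | h2
        · left
          refine ⟨Ioo (a : ℝ) b, Ioo_mem_nhds h1 h2, ?_⟩
          intro q hq
          exact ⟨by exact_mod_cast hq.1, by exact_mod_cast hq.2⟩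
        · right
          refine ⟨Ioi (b : ℝ), Ioi_mem_nhds h2, ?_⟩
          intro q hq hq'
          have hq : (b : ℝ) < q := hq
          have := hq'.2
          have : b < q := by exact_mod_cast hq
          linarith

/-- The point of the space of ultrafilters attached to a point of the compactified line. -/
noncomputable def pG (x : OnePoint ℝ) : UltraCons ratBddIntervals :=
  UC.ofFilter (pF x) (pF_neBot x) (cons_decide _ (pF_basic x))

theorem mem_pG {x : OnePoint ℝ} {s : Set ℚ} :
    s ∈ (pG x).sets ↔ IsCons ratBddIntervals s ∧ s ∈ pF x := Iff.rfl

theorem pG_rat (q : ℚ) : pG ((q : ℝ) : OnePoint ℝ) = typeOf ratBddIntervals q := by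
  apply UC.ext'
  ext s
  rw [mem_pG, pF_rat, mem_pure]
  rfl

theorem pF_open {s : Set ℚ} (hs : IsOpen s) : IsOpen {x | s ∈ pF x} := by
  rw [OnePoint.isOpen_def]
  have hop : IsOpen ((↑) ⁻¹' {x | s ∈ pF x} : Set ℝ) := by
    rw [isOpen_iff_mem_nhds]
    intro r hr
    change s ∈ pF (r : OnePoint ℝ) at hr
    have h1 : s ∈ comap ((↑) : ℚ → ℝ) (𝓝 r) := by
      by_cases h : r ∈ Set.range ((↑) : ℚ → ℝ)
      · obtain ⟨q, rfl⟩ := h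
        rw [pF_rat, mem_pure] at hr
        rw [← Rat.isUniformEmbedding_coe_real.isEmbedding.isInducing.nhds_eq_comap]
        exact hs.mem_nhds hr
      · rwa [pF_coe, rF, if_neg h] at hr
    obtain ⟨t, ht, hts⟩ := h1
    filter_upwards [eventually_mem_nhds_iff.2 ht] with y hy
    change s ∈ pF (y : OnePoint ℝ)
    rw [pF_coe]
    exact ⟨t, rF_le y hy, hts⟩
  refine ⟨?_, hop⟩
  intro hinf
  change s ∈ pF OnePoint.infty at hinf
  rw [pF_infty] at hinf
  obtain ⟨t, ht, hts⟩ := hinf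
  replace ht : Bornology.IsBounded tᶜ := Bornology.isBounded_compl_iff.2 ht
  obtain ⟨M, hM⟩ := ht.subset_closedBall 0
  refine (isCompact_closedBall (0 : ℝ) M).of_isClosed_subset hop.isClosed_compl ?_
  intro y hy
  by_contra hyM
  apply hy
  change s ∈ pF (y : OnePoint ℝ)
  rw [pF_coe]
  refine ⟨t, rF_le y ?_, hts⟩
  filter_upwards [Metric.isClosed_closedBall.isOpen_compl.mem_nhds hyM] with z hz
  by_contra hzt
  exact hz (hM hzt)

theorem pG_cont : Continuous pG := by
  apply continuous_generateFrom_iff.2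
  rintro _ ⟨b, hb, hbo, rfl⟩
  convert pF_open hbo using 1
  ext x
  exact ⟨fun h => h.2, fun h => ⟨hb, h⟩⟩

theorem cons_Icc {a b : ℚ} (hab : a ≤ b) : IsCons ratBddIntervals (Icc a b) := by
  have h (c d : ℚ) : IsCons ratBddIntervals (Ioo c d) := IsCons.basic _ (Or.inr ⟨c, d, rfl⟩)
  convert IsCons.inter _ _ (IsCons.inter _ _ (h (a - 1) (b + 1)) (IsCons.compl _ (h (a - 1) a)))
    (IsCons.compl _ (h b (b + 1))) using 1
  ext x
  simp only [mem_Icc, mem_inter_iff, mem_Ioo, mem_compl_iff]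
  constructor
  · rintro ⟨h1, h2⟩
    exact ⟨⟨⟨by linarith, by linarith⟩, by rintro ⟨_, _⟩; linarith⟩, by rintro ⟨_, _⟩; linarith⟩
  · rintro ⟨⟨⟨h1, h2⟩, h3⟩, h4⟩
    constructor
    · by_contra! h; exact h3 ⟨h1, h⟩
    · by_contra! h; exact h4 ⟨h, h2⟩

theorem isOpen_tilde {b : Set X} [TopologicalSpace X] (hb : IsCons B b) (hbo : IsOpen b) :
    IsOpen (tilde B b) := isOpen_generateFrom_of_mem ⟨b, hb, hbo, rfl⟩

theorem Ioo_mem_pF {a b : ℚ} {r : ℝ} (ha : a < r) (hb : r < b) : Ioo a b ∈ pF (r : OnePoint ℝ) := by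
  rw [pF_coe]
  refine ⟨Ioo (a : ℝ) b, rF_le r (Ioo_mem_nhds ha hb), ?_⟩
  intro q hq
  exact ⟨by exact_mod_cast hq.1, by exact_mod_cast hq.2⟩

/-- Separation by disjoint open constructible sets. -/
def PSep (x y : OnePoint ℝ) : Prop :=
  ∃ b c : Set ℚ, IsCons ratBddIntervals b ∧ IsCons ratBddIntervals c ∧ IsOpen b ∧ IsOpen c ∧
    b ∩ c = ∅ ∧ b ∈ pF x ∧ c ∈ pF y

theorem PSep.symm {x y : OnePoint ℝ} (h : PSep x y) : PSep y x := by
  obtain ⟨b, c, h1, h2, h3, h4, h5, h6, h7⟩ := h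
  exact ⟨c, b, h2, h1, h4, h3, by rw [inter_comm, h5], h7, h6⟩

theorem sep_infty (r : ℝ) : PSep r OnePoint.infty := by
  obtain ⟨a, ha⟩ := exists_rat_lt r
  obtain ⟨b, hb⟩ := exists_rat_gt r
  have hab : a ≤ b := by
    have : (a : ℝ) < b := ha.trans hb
    exact_mod_cast this.le
  refine ⟨Ioo a b, (Icc a b)ᶜ, IsCons.basic _ (Or.inr ⟨a, b, rfl⟩), (cons_Icc hab).compl, isOpen_Ioo,
    isClosed_Icc.isOpen_compl, ?_, Ioo_mem_pF ha hb, ?_⟩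
  · rw [eq_empty_iff_forall_notMem]
    exact fun x hx => hx.2 (Ioo_subset_Icc_self hx.1)
  · rw [pF_infty]
    refine ⟨(Icc (a : ℝ) b)ᶜ, Metric.isBounded_Icc (a : ℝ) b, ?_⟩
    intro q hq hq'
    exact hq ⟨by exact_mod_cast hq'.1, by exact_mod_cast hq'.2⟩

theorem sep_lt {r s : ℝ} (h : r < s) : PSep r s := by
  obtain ⟨a, ha⟩ := exists_rat_lt r
  obtain ⟨c, hc, hc'⟩ := exists_rat_btwn h
  obtain ⟨b, hb⟩ := exists_rat_gt s
  refine ⟨Ioo a c, Ioo c b, IsCons.basic _ (Or.inr ⟨a, c, rfl⟩), IsCons.basic _ (Or.inr ⟨c, b, rfl⟩),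
    isOpen_Ioo, isOpen_Ioo, ?_, Ioo_mem_pF ha hc, Ioo_mem_pF hc' hb⟩
  rw [eq_empty_iff_forall_notMem]
  exact fun x hx => lt_asymm hx.1.2 hx.2.1

theorem sep_ne {x y : OnePoint ℝ} (h : x ≠ y) : PSep x y := by
  induction x using OnePoint.rec with
  | infty =>
    induction y using OnePoint.rec with
    | infty => exact absurd rfl h
    | coe s => exact (sep_infty s).symm
  | coe r =>
    induction y using OnePoint.rec with
    | infty => exact sep_infty r
    | coe s =>
      have : r ≠ s := fun e => h (by rw [e])
      rcases lt_or_gt_of_ne this with h | h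
      · exact sep_lt h
      · exact (sep_lt h).symm

theorem pG_sep {x y : OnePoint ℝ} (h : x ≠ y) : ∃ U V : Set (UltraCons ratBddIntervals),
    IsOpen U ∧ IsOpen V ∧ pG x ∈ U ∧ pG y ∈ V ∧ Disjoint U V := by
  obtain ⟨b, c, h1, h2, h3, h4, h5, h6, h7⟩ := sep_ne h
  refine ⟨_, _, isOpen_tilde h1 h3, isOpen_tilde h2 h4, ⟨h1, h6⟩, ⟨h2, h7⟩, ?_⟩
  rw [Set.disjoint_left]
  intro p hb hc
  apply p.not_empty_mem
  rw [← h5]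
  exact p.inter_mem _ hb _ hc

theorem exists_spec (p : UltraCons ratBddIntervals) : ∃ x, p ⤳ pG x := by
  let F : Filter ℚ :=
    { sets := {s | ∃ t ∈ p.sets, t ⊆ s}
      univ_sets := ⟨univ, UC.univ_mem p, subset_rfl⟩
      sets_of_superset := fun ⟨t, ht, hts⟩ h => ⟨t, ht, hts.trans h⟩
      inter_sets := fun ⟨t, ht, hts⟩ ⟨u, hu, hus⟩ =>
        ⟨t ∩ u, p.inter_mem _ ht _ hu, inter_subset_inter hts hus⟩ }
  have hmem : ∀ t ∈ p.sets, t ∈ F := fun t ht => ⟨t, ht, subset_rfl⟩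
  have hF : F.NeBot := by
    rw [← empty_mem_iff_bot.not.trans neBot_iff.symm]
    rintro ⟨t, ht, h⟩
    rw [subset_empty_iff.1 h] at ht
    exact p.not_empty_mem ht
  let U := Ultrafilter.of F
  have hU : (U : Filter ℚ) ≤ F := Ultrafilter.of_le F
  obtain ⟨x, -, hx⟩ := isCompact_univ.ultrafilter_le_nhds
    (U.map (fun q : ℚ => ((q : ℝ) : OnePoint ℝ))) (by simp)
  refine ⟨x, ?_⟩
  rw [specializes_iff_pure]
  rw [show 𝓝 (pG x) = _ from nhds_generateFrom (a := pG x)]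
  refine le_iInf₂ ?_
  rintro _ ⟨hxb, b, hb, hbo, rfl⟩
  rw [le_principal_iff, mem_pure]
  have h1 : {y | b ∈ pF y} ∈ 𝓝 x := (pF_open hbo).mem_nhds hxb.2
  have h2 : b ∈ U := by
    have := hx h1
    rw [Ultrafilter.coe_map, mem_map] at this
    filter_upwards [this] with q hq
    have hq : b ∈ pF ((q : ℝ) : OnePoint ℝ) := hq
    rwa [pF_rat, mem_pure] at hq
  rcases UC.mem_or p hb with h | h
  · exact h
  · exact absurd h2 (Ultrafilter.compl_mem_iff_notMem.1 (hU (hmem _ h)))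

theorem pG_inj_spec {x y : OnePoint ℝ} (h : pG x ⤳ pG y) : x = y := by
  by_contra hxy
  obtain ⟨U, V, hU, hV, hx, hy, hd⟩ := pG_sep hxy
  exact Set.disjoint_left.1 hd hx (h.mem_open hV hy)

theorem eq_of_spec {p q : UltraCons ratBddIntervals} (h : p ⤳ q) (h' : q ⤳ p) : p = q := by
  apply UC.eq_of
  intro s hs
  have ho : IsOpen s := by
    rcases hs with rfl | ⟨a, b, rfl⟩
    · exact isOpen_empty
    · exact isOpen_Ioo
  have := isOpen_tilde (IsCons.basic _ hs) ho
  exact ⟨fun hp => h'.mem_open this hp, fun hq => h.mem_open this hq⟩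

theorem pG_closed (x : OnePoint ℝ) : IsClosed ({pG x} : Set (UltraCons ratBddIntervals)) := by
  apply isClosed_of_closure_subset
  intro q hq
  have h1 : pG x ⤳ q := specializes_iff_mem_closure.2 hq
  obtain ⟨y, hy⟩ := exists_spec q
  obtain rfl := pG_inj_spec (h1.trans hy)
  exact eq_of_spec hy h1

end Helpers

theorem stmt_7 :
    ∃ (e : {p : UltraCons ratBddIntervals //
        IsClosed ({p} : Set (UltraCons ratBddIntervals))} ≃ₜ OnePoint ℝ)
      (h : ∀ x : ℚ, IsClosed ({typeOf ratBddIntervals x} : Set (UltraCons ratBddIntervals))),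
      ∀ x : ℚ, e ⟨typeOf ratBddIntervals x, h x⟩ = ((x : ℝ) : OnePoint ℝ) := by
  let g : OnePoint ℝ → {p : UltraCons ratBddIntervals //
      IsClosed ({p} : Set (UltraCons ratBddIntervals))} := fun x => ⟨pG x, pG_closed x⟩
  have hg : Continuous g := pG_cont.subtype_mk _
  have hinj : Function.Injective g := fun x y h =>
    pG_inj_spec (specializes_of_eq (congrArg Subtype.val h))
  have hsurj : Function.Surjective g := by
    rintro ⟨p, hp⟩
    obtain ⟨x, hx⟩ := exists_spec p
    refine ⟨x, Subtype.ext ?_⟩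
    have := specializes_iff_mem_closure.1 hx
    rwa [hp.closure_eq] at this
  have : T2Space {p : UltraCons ratBddIntervals //
      IsClosed ({p} : Set (UltraCons ratBddIntervals))} := by
    refine ⟨fun a b hab => ?_⟩
    obtain ⟨x, rfl⟩ := hsurj a
    obtain ⟨y, rfl⟩ := hsurj b
    obtain ⟨U, V, hU, hV, hx, hy, hd⟩ := pG_sep (fun e : x = y => hab (by rw [e]))
    exact ⟨_, _, hU.preimage continuous_subtype_val, hV.preimage continuous_subtype_val, hx, hy,
      hd.preimage _⟩
  let E := Equiv.ofBijective g ⟨hinj, hsurj⟩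
  have hE : Continuous E := hg
  refine ⟨hE.homeoOfEquivCompactToT2.symm, fun x => pG_rat x ▸ pG_closed _, fun x => ?_⟩
  rw [Homeomorph.symm_apply_eq]
  exact Subtype.ext (pG_rat x).symm
end

section
/- Let X be a topological space and A ⊆ X a subset. If A has a basis of normal neighbourhoods in X (every neighbourhood of A in X contains a neighbourhood W of A such that W, with the subspace topology, is normal), then A with the subspace topology is normal. -/
theorem stmt_8 {X : Type*} [TopologicalSpace X] (A : Set X)
    (h : ∀ V ∈ nhdsSet A, ∃ W ∈ nhdsSet A, W ⊆ V ∧ NormalSpace W) :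
    NormalSpace A := by
  constructor
  intro s t hs ht hst
  obtain ⟨C, hC, rfl⟩ := isClosed_induced_iff.1 hs
  obtain ⟨D, hD, rfl⟩ := isClosed_induced_iff.1 ht
  have hV : (C ∩ D)ᶜ ∈ nhdsSet A := by
    refine (hC.inter hD).isOpen_compl.mem_nhdsSet.2 ?_
    intro x hx hx'
    exact Set.disjoint_left.1 hst (show (⟨x, hx⟩ : A) ∈ Subtype.val ⁻¹' C from hx'.1) hx'.2
  obtain ⟨W, hW, hWV, hN⟩ := h _ hV
  have hAW : A ⊆ W := subset_of_mem_nhdsSet hW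
  have hd : Disjoint ((Subtype.val : W → X) ⁻¹' C) (Subtype.val ⁻¹' D) :=
    Set.disjoint_left.2 fun x h1 h2 => hWV x.2 ⟨h1, h2⟩
  obtain ⟨U, V, hU, hV, hCU, hDV, hUV⟩ := hN.normal _ _
    (hC.preimage continuous_subtype_val) (hD.preimage continuous_subtype_val) hd
  have hc : Continuous (Set.inclusion hAW) := continuous_inclusion hAW
  exact ⟨Set.inclusion hAW ⁻¹' U, Set.inclusion hAW ⁻¹' V, hU.preimage hc, hV.preimage hc,
    fun x hx => hCU (a := Set.inclusion hAW x) hx,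
    fun x hx => hDV (a := Set.inclusion hAW x) hx, hUV.preimage _⟩
end

section
/- Let X be a topological space and A ⊆ X a subset. If A has a basis of paracompact neighbourhoods in X (every neighbourhood of A in X contains a neighbourhood W of A such that W, with the subspace topology, is paracompact), then A with the subspace topology is paracompact. -/
theorem stmt_9 {X : Type*} [TopologicalSpace X] (A : Set X)
    (h : ∀ V ∈ nhdsSet A, ∃ W ∈ nhdsSet A, W ⊆ V ∧ ParacompactSpace W) :
    ParacompactSpace A := by
  refine ⟨fun α s ho hu => ?_⟩
  choose U hUo hU using fun a => isOpen_induced_iff.1 (ho a)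
  have hAU : A ⊆ ⋃ a, U a := by
    intro x hx
    obtain ⟨a, ha⟩ := Set.iUnion_eq_univ_iff.1 hu ⟨x, hx⟩
    rw [← hU a] at ha
    exact Set.mem_iUnion.2 ⟨a, ha⟩
  obtain ⟨W, hW, hWU, hP⟩ := h _ ((isOpen_iUnion hUo).mem_nhdsSet.2 hAU)
  have hAW : A ⊆ W := subset_of_mem_nhdsSet hW
  obtain ⟨v, vo, vc, vf, vs⟩ := precise_refinement (X := W)
    (fun a => (Subtype.val ⁻¹' U a : Set W))
    (fun a => (hUo a).preimage continuous_subtype_val)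
    (Set.iUnion_eq_univ_iff.2 fun x => by simpa using hWU x.2)
  have hc : Continuous (Set.inclusion hAW) := continuous_inclusion hAW
  refine ⟨α, fun a => Set.inclusion hAW ⁻¹' v a, fun a => (vo a).preimage hc, ?_,
    vf.preimage_continuous hc, fun a => ⟨a, ?_⟩⟩
  · exact Set.iUnion_eq_univ_iff.2 fun x => Set.iUnion_eq_univ_iff.1 vc (Set.inclusion hAW x)
  · intro x hx
    rw [← hU a]
    exact vs a hx
end
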